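/- arXiv:1005.1438 — 2 statements merged into one kernel-verified Lean document; each statement's English description precedes it below -/
import Mathlib

section
/- Let Φ : ℂⁿ → ℂⁿ be a continuous open map (the image of every open set is open) whose restriction to the open ball B(0, R) is injective, where R > 0. If w₁ and w₂ are points of the closed ball of radius R centered at 0 with w₁ ≠ w₂ and Φ(w₁) = Φ(w₂), then ‖w₁‖ = ‖w₂‖ = R, and Φ(w₁) is a boundary point of the set Φ(B(0, R)). -/
open MeasureTheory Metric

/-- If an open continuous map is injective on an open set `s`, then no point of `s` is
identified with another point of `closure s`. -/
theorem IsOpenMap.eq_of_mem_closure_of_injOn {X Y : Type*} [TopologicalSpace X] [T2Space X]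
    [TopologicalSpace Y] {f : X → Y} (ho : IsOpenMap f) (hc : Continuous f) {s : Set X}
    (hs : IsOpen s) (hinj : Set.InjOn f s) {a b : X} (ha : a ∈ closure s) (hb : b ∈ s)
    (hab : f a = f b) : a = b := by
  by_contra hne
  obtain ⟨U, V, hU, hV, haU, hbV, hUV⟩ := t2_separation hne
  have hW : IsOpen (U ∩ f ⁻¹' (f '' (V ∩ s))) :=
    hU.inter ((ho _ (hV.inter hs)).preimage hc)
  obtain ⟨x, ⟨hxU, y, ⟨hyV, hys⟩, hyx⟩, hxs⟩ :=
    mem_closure_iff.1 ha _ hW ⟨haU, b, ⟨hbV, hb⟩, hab.symm⟩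
  exact Set.disjoint_left.1 hUV hxU (hinj hys hxs hyx ▸ hyV)

/-- Let `Φ : ℂⁿ → ℂⁿ` be a continuous open map injective on the open ball `B(0, R)`, `R > 0`.
If `w₁ ≠ w₂` are points of the closed ball of radius `R` with `Φ w₁ = Φ w₂`, then
`‖w₁‖ = ‖w₂‖ = R` and `Φ w₁` is a boundary point of `Φ '' B(0, R)`. -/
theorem norm_eq_and_frontier_of_glued_points (n : ℕ)
    (Φ : EuclideanSpace ℂ (Fin n) → EuclideanSpace ℂ (Fin n))
    (hc : Continuous Φ) (ho : IsOpenMap Φ)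
    (R : ℝ) (hR : 0 < R)
    (hinj : Set.InjOn Φ (ball (0 : EuclideanSpace ℂ (Fin n)) R))
    (w₁ w₂ : EuclideanSpace ℂ (Fin n))
    (hw₁ : w₁ ∈ closedBall (0 : EuclideanSpace ℂ (Fin n)) R)
    (hw₂ : w₂ ∈ closedBall (0 : EuclideanSpace ℂ (Fin n)) R)
    (hne : w₁ ≠ w₂) (heq : Φ w₁ = Φ w₂) :
    ‖w₁‖ = R ∧ ‖w₂‖ = R ∧
      Φ w₁ ∈ frontier (Φ '' ball (0 : EuclideanSpace ℂ (Fin n)) R) := by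
  have hcl := closure_ball (0 : EuclideanSpace ℂ (Fin n)) hR.ne'
  rw [← hcl] at hw₁ hw₂
  have key {a b : EuclideanSpace ℂ (Fin n)} (ha : a ∈ closure (ball 0 R)) (hb : b ∈ ball 0 R)
      (hab : Φ a = Φ b) : a = b :=
    ho.eq_of_mem_closure_of_injOn hc isOpen_ball hinj ha hb hab
  have h₁ : w₁ ∉ ball 0 R := fun h => hne (key hw₂ h heq.symm).symm
  have h₂ : w₂ ∉ ball 0 R := fun h => hne (key hw₁ h heq)
  have norm_eq {w : EuclideanSpace ℂ (Fin n)} (hw : w ∈ closure (ball 0 R))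
      (h : w ∉ ball 0 R) : ‖w‖ = R := by
    rw [hcl, mem_closedBall_zero_iff] at hw
    rw [mem_ball_zero_iff, not_lt] at h
    exact le_antisymm hw h
  refine ⟨norm_eq hw₁ h₁, norm_eq hw₂ h₂, ?_⟩
  rw [(ho _ isOpen_ball).frontier_eq]
  refine ⟨image_closure_subset_closure_image hc ⟨w₁, hw₁, rfl⟩, ?_⟩
  rintro ⟨b, hb, hbw⟩
  exact h₁ (key hw₁ hb hbw.symm ▸ hb)
end

section
/- Let Φ : ℂⁿ → ℂⁿ be a Keller map that is not injective, and set R = sup{ r > 0 : the restriction of Φ to B(0, r) is injective }. Then 0 < R < ∞, the restriction of Φ to the open ball B(0, R) is injective, and there exist points w₁ ≠ w₂ with ‖w₁‖ = ‖w₂‖ = R and Φ(w₁) = Φ(w₂). -/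
open MeasureTheory Metric MvPolynomial

/-- A continuous open map that is injective on an open set `S` does not identify a point of
`S` with another point of the closure of `S`. -/
theorem IsOpenMap.eq_of_injOn_of_mem_closure {X Y : Type*} [TopologicalSpace X] [T2Space X]
    [TopologicalSpace Y] {f : X → Y} (hopen : IsOpenMap f) (hcont : Continuous f)
    {S : Set X} (hS : IsOpen S) (hinj : Set.InjOn f S) {a b : X} (ha : a ∈ S)
    (hb : b ∈ closure S) (hab : f a = f b) : a = b := by
  by_contra hne
  obtain ⟨U, V, hU, hV, haU, hbV, hUV⟩ := t2_separation hne
  have hW : IsOpen (V ∩ f ⁻¹' (f '' (U ∩ S))) :=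
    hV.inter ((hopen _ (hU.inter hS)).preimage hcont)
  obtain ⟨c, ⟨hcV, u, ⟨huU, huS⟩, huc⟩, hcS⟩ :=
    mem_closure_iff.1 hb _ hW ⟨hbV, a, ⟨haU, ha⟩, hab⟩
  have hcu : u = c := hinj huS hcS huc
  exact Set.disjoint_left.1 hUV huU (hcu ▸ hcV)

/-- A continuous locally injective map that is injective on a closed ball of a proper real normed
space is injective on a strictly larger open ball. -/
theorem Set.InjOn.exists_lt_injOn_ball {E Y : Type*} [NormedAddCommGroup E] [NormedSpace ℝ E]
    [ProperSpace E] [TopologicalSpace Y] [T2Space Y] {f : E → Y} (hcont : Continuous f)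
    (hloc : ∀ x, ∃ U ∈ nhds x, Set.InjOn f U) {x : E} {R : ℝ} (hR : 0 ≤ R)
    (hinj : Set.InjOn f (closedBall x R)) : ∃ r, R < r ∧ Set.InjOn f (ball x r) := by
  obtain ⟨t, ht, hft⟩ := hinj.exists_mem_nhdsSet (isCompact_closedBall x R)
    (fun y _ => hcont.continuousAt) (fun y _ => hloc y)
  obtain ⟨U, hU, hRU, hUt⟩ := mem_nhdsSet_iff_exists.1 ht
  obtain ⟨δ, hδ, hδU⟩ := (isCompact_closedBall x R).exists_thickening_subset_open hU hRU
  rw [thickening_closedBall hδ hR] at hδU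
  exact ⟨δ + R, by linarith, hft.mono (hδU.trans hUt)⟩

/-- A non-injective continuous, open, locally injective map on a proper real normed space
has a finite positive critical radius, and it identifies two points of the critical sphere. -/
theorem IsOpenMap.critical_radius {E Y : Type*} [NormedAddCommGroup E] [NormedSpace ℝ E]
    [ProperSpace E] [TopologicalSpace Y] [T2Space Y] {f : E → Y} (hopen : IsOpenMap f)
    (hcont : Continuous f) (hloc : ∀ x, ∃ U ∈ nhds x, Set.InjOn f U)
    (hninj : ¬ Function.Injective f) {R : ℝ}
    (hRdef : R = sSup {r : ℝ | 0 < r ∧ Set.InjOn f (ball (0 : E) r)}) :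
    0 < R ∧ BddAbove {r : ℝ | 0 < r ∧ Set.InjOn f (ball (0 : E) r)} ∧
      Set.InjOn f (ball (0 : E) R) ∧
      ∃ w₁ w₂ : E, w₁ ≠ w₂ ∧ ‖w₁‖ = R ∧ ‖w₂‖ = R ∧ f w₁ = f w₂ := by
  set A := {r : ℝ | 0 < r ∧ Set.InjOn f (ball (0 : E) r)} with hA
  have hbdd : BddAbove A := by
    simp only [Function.Injective, not_forall] at hninj
    obtain ⟨a, b, hab, hne⟩ := hninj
    refine ⟨max ‖a‖ ‖b‖, fun r hr => ?_⟩
    by_contra! hlt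
    rw [max_lt_iff] at hlt
    exact hne (hr.2 (mem_ball_zero_iff.2 hlt.1) (mem_ball_zero_iff.2 hlt.2) hab)
  obtain ⟨U, hU, hfU⟩ := hloc 0
  obtain ⟨ε, hε, hεU⟩ := Metric.mem_nhds_iff.1 hU
  have hεA : ε ∈ A := ⟨hε, hfU.mono hεU⟩
  have hR : 0 < R := hε.trans_le (hRdef ▸ le_csSup hbdd hεA)
  have hinj : Set.InjOn f (ball (0 : E) R) := by
    intro a ha b hb hab
    rw [mem_ball_zero_iff] at ha hb
    obtain ⟨r, hr, hlt⟩ := exists_lt_of_lt_csSup ⟨ε, hεA⟩ (hRdef ▸ max_lt ha hb)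
    rw [max_lt_iff] at hlt
    exact hr.2 (mem_ball_zero_iff.2 hlt.1) (mem_ball_zero_iff.2 hlt.2) hab
  refine ⟨hR, hbdd, hinj, ?_⟩
  have hclosed : ¬ Set.InjOn f (closedBall (0 : E) R) := fun h => by
    obtain ⟨r, hRr, hr⟩ := h.exists_lt_injOn_ball hcont hloc hR.le
    exact hRr.not_ge (hRdef ▸ le_csSup hbdd ⟨hR.trans hRr, hr⟩)
  have hnorm : ∀ {a b : E}, ‖a‖ ≤ R → ‖b‖ ≤ R → f a = f b → a ≠ b → ‖a‖ = R := by
    intro a b ha hb hab hne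
    refine ha.eq_of_not_lt fun hlt => hne ?_
    refine hopen.eq_of_injOn_of_mem_closure hcont isOpen_ball hinj (mem_ball_zero_iff.2 hlt) ?_ hab
    rw [closure_ball _ hR.ne']
    exact mem_closedBall_zero_iff.2 hb
  simp only [Set.InjOn, not_forall] at hclosed
  obtain ⟨a, ha, b, hb, hab, hne⟩ := hclosed
  rw [mem_closedBall_zero_iff] at ha hb
  exact ⟨a, b, hne, hnorm ha hb hab hne, hnorm hb ha hab.symm (Ne.symm hne), hab⟩

/-- A map of `ℂⁿ` with polynomial coordinates is smooth. -/
theorem contDiff_of_forall_eq_eval {ι κ : Type*} [Fintype ι] [Fintype κ]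
    {Φ : EuclideanSpace ℂ ι → EuclideanSpace ℂ κ} (p : κ → MvPolynomial ι ℂ)
    (hp : ∀ x j, Φ x j = MvPolynomial.eval (fun i => x i) (p j)) {m : WithTop ℕ∞} :
    ContDiff ℂ m Φ := by
  rw [contDiff_euclidean]
  intro j
  simp only [hp]
  induction p j using MvPolynomial.induction_on with
  | C a => simpa using contDiff_const
  | add q r hq hr => simpa using hq.add hr
  | mul_X q i hq => simpa using hq.mul (contDiff_piLp_apply (p := 2) (i := i))

/-- If a Keller map `Φ : ℂⁿ → ℂⁿ` is not injective and
`R = sup {r > 0 : Φ is injective on B(0, r)}`, then `0 < R < ∞` (the set of such radii is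
bounded above), the restriction of `Φ` to `B(0, R)` is injective, and there exist two distinct
points `w₁ ≠ w₂` of norm `R` with `Φ w₁ = Φ w₂`. -/
theorem keller_map_critical_radius (n : ℕ)
    (Φ : EuclideanSpace ℂ (Fin n) → EuclideanSpace ℂ (Fin n))
    (p : Fin n → MvPolynomial (Fin n) ℂ)
    (hp : ∀ (x : EuclideanSpace ℂ (Fin n)) (j : Fin n),
      Φ x j = MvPolynomial.eval (fun i => x i) (p j))
    (hdet : ∀ x : EuclideanSpace ℂ (Fin n), (fderiv ℂ Φ x).det = 1)
    (hninj : ¬ Function.Injective Φ)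
    (R : ℝ)
    (hRdef : R = sSup {r : ℝ | 0 < r ∧ Set.InjOn Φ (ball (0 : EuclideanSpace ℂ (Fin n)) r)}) :
    0 < R ∧
    BddAbove {r : ℝ | 0 < r ∧ Set.InjOn Φ (ball (0 : EuclideanSpace ℂ (Fin n)) r)} ∧
    Set.InjOn Φ (ball (0 : EuclideanSpace ℂ (Fin n)) R) ∧
    ∃ w₁ w₂ : EuclideanSpace ℂ (Fin n),
      w₁ ≠ w₂ ∧ ‖w₁‖ = R ∧ ‖w₂‖ = R ∧ Φ w₁ = Φ w₂ := by
  have hΦ : ContDiff ℂ 1 Φ := contDiff_of_forall_eq_eval p hp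
  have hstrict : ∀ x, HasStrictFDerivAt Φ
      ((fderiv ℂ Φ x).toContinuousLinearEquivOfDetNeZero (by simp [hdet x]) :
        EuclideanSpace ℂ (Fin n) →L[ℂ] EuclideanSpace ℂ (Fin n)) x := fun x => by
    rw [ContinuousLinearMap.coe_toContinuousLinearEquivOfDetNeZero]
    exact hΦ.contDiffAt.hasStrictFDerivAt one_ne_zero
  have hloc : ∀ x, ∃ U ∈ nhds x, Set.InjOn Φ U := fun x =>
    ⟨_, (hstrict x).toOpenPartialHomeomorph.open_source.mem_nhds
      (hstrict x).mem_toOpenPartialHomeomorph_source,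
      (hstrict x).toOpenPartialHomeomorph.injOn⟩
  exact (isOpenMap_of_hasStrictFDerivAt_equiv hstrict).critical_radius hΦ.continuous hloc hninj
    hRdef
end
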